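/- For every nonnegative integer n, NT2(1,5,n) − NT2(4,5,n) + 2·NT2(2,5,n) − 2·NT2(3,5,n) ≡ N_2(2,5,n) − N_2(1,5,n) (mod 5). -/

import Mathlib

/-- A partition without repeated odd parts: a multiset of positive parts in which
every odd part occurs at most once. -/
structure OddDistinctPartition where
  parts : Multiset ℕ
  parts_pos : ∀ p ∈ parts, 0 < p
  odd_distinct : ∀ p, Odd p → parts.count p ≤ 1

namespace OddDistinctPartition

/-- The number being partitioned. -/
def wt (lam : OddDistinctPartition) : ℕ := lam.parts.sum

/-- The number of parts. -/
def numParts (lam : OddDistinctPartition) : ℕ := Multiset.card lam.parts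

/-- The largest part (`0` for the empty partition). -/
def largest (lam : OddDistinctPartition) : ℕ := lam.parts.sup

/-- The M2-rank: ⌈ℓ(λ)/2⌉ − n(λ). -/
def m2Rank (lam : OddDistinctPartition) : ℤ :=
  (((lam.largest + 1) / 2 : ℕ) : ℤ) - (lam.numParts : ℤ)

end OddDistinctPartition

/-- Total number of parts in the partitions of `n` without repeated odd parts with
M2-rank ≡ `b` (mod `k`), counted as the number of such partitions with a marked part. -/
noncomputable def NT2 (b k n : ℕ) : ℕ :=
  Nat.card {p : OddDistinctPartition × ℕ //
    p.1.wt = n ∧ p.1.m2Rank ≡ (b : ℤ) [ZMOD (k : ℤ)] ∧ p.2 < p.1.numParts}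

/-- The number of partitions of `n` without repeated odd parts with M2-rank ≡ `b` (mod `k`). -/
noncomputable def N2 (b k n : ℕ) : ℕ :=
  Nat.card {lam : OddDistinctPartition // lam.wt = n ∧ lam.m2Rank ≡ (b : ℤ) [ZMOD (k : ℤ)]}

namespace OddDistinctPartition

/-- The number of parts that are at least `t`. -/
def numPartsGE (lam : OddDistinctPartition) (t : ℕ) : ℕ := lam.parts.countP (t ≤ ·)

/-- The sum of the entries of the `j`-th column (counted from `0`) of the 2-modular diagram. -/
def columnSum (lam : OddDistinctPartition) (j : ℕ) : ℕ :=
  lam.numPartsGE (2 * j + 1) + lam.numPartsGE (2 * j + 2)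

/-- The number of columns of the 2-modular diagram. -/
def numColumns (lam : OddDistinctPartition) : ℕ := (lam.largest + 1) / 2

theorem parts_injective : Function.Injective parts := by
  rintro ⟨a, _, _⟩ ⟨b, _, _⟩ h
  cases h
  rfl

theorem numPartsGE_eq_add_count (lam : OddDistinctPartition) (t : ℕ) :
    lam.numPartsGE t = lam.numPartsGE (t + 1) + lam.parts.count t := by
  unfold numPartsGE
  induction lam.parts using Multiset.induction_on with
  | empty => simp
  | cons a s ih =>
    simp only [Multiset.countP_cons, Multiset.count_cons, ih]
    split_ifs <;> omega

theorem numPartsGE_antitone (lam : OddDistinctPartition) : Antitone lam.numPartsGE :=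
  antitone_nat_of_succ_le fun t => by
    rw [lam.numPartsGE_eq_add_count t]
    exact Nat.le_add_right _ _

theorem numPartsGE_one (lam : OddDistinctPartition) : lam.numPartsGE 1 = lam.numParts :=
  Multiset.countP_eq_card.2 lam.parts_pos

theorem numPartsGE_pos_iff (lam : OddDistinctPartition) {t : ℕ} (ht : 0 < t) :
    0 < lam.numPartsGE t ↔ t ≤ lam.largest := by
  rw [numPartsGE, Multiset.countP_pos]
  refine ⟨fun ⟨p, hp, htp⟩ => htp.trans (Multiset.le_sup hp), fun h => ?_⟩
  by_contra! hlt
  have : lam.largest ≤ t - 1 := Multiset.sup_le.2 fun p hp => by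
    have := hlt p hp
    omega
  omega

theorem numPartsGE_eq_zero (lam : OddDistinctPartition) {t : ℕ} (ht : 2 * lam.numColumns < t) :
    lam.numPartsGE t = 0 := by
  by_contra h
  have := (lam.numPartsGE_pos_iff (t := t) (by omega)).1 (Nat.pos_of_ne_zero h)
  unfold numColumns at ht
  omega

theorem sum_countP_le (s : Multiset ℕ) (N : ℕ) (h : ∀ p ∈ s, p ≤ N) :
    ∑ t ∈ Finset.range N, s.countP (t + 1 ≤ ·) = s.sum := by
  induction s using Multiset.induction_on with
  | empty => simp
  | cons a s ih =>
    simp only [Multiset.countP_cons, Finset.sum_add_distrib, Multiset.sum_cons]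
    rw [ih fun p hp => h p (Multiset.mem_cons_of_mem hp), ← Finset.card_filter]
    have ha := h a (Multiset.mem_cons_self a s)
    have : (Finset.range N).filter (fun t => t + 1 ≤ a) = Finset.range a := by
      ext t
      simp only [Finset.mem_filter, Finset.mem_range]
      omega
    rw [this, Finset.card_range, add_comm]

theorem sum_columnSum (lam : OddDistinctPartition) :
    ∑ j ∈ Finset.range lam.numColumns, lam.columnSum j = lam.wt := by
  have pair (m : ℕ) : ∑ j ∈ Finset.range m, lam.columnSum j =
      ∑ t ∈ Finset.range (2 * m), lam.numPartsGE (t + 1) := by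
    induction m with
    | zero => simp
    | succ m ih =>
      rw [Finset.sum_range_succ, ih, show 2 * (m + 1) = 2 * m + 1 + 1 by ring,
        Finset.sum_range_succ, Finset.sum_range_succ, columnSum]
      ring
  rw [pair]
  refine sum_countP_le _ _ fun p hp => ?_
  have : p ≤ lam.largest := Multiset.le_sup hp
  unfold numColumns
  omega

theorem columnSum_antitone (lam : OddDistinctPartition) : Antitone lam.columnSum := fun i j h =>
  add_le_add (lam.numPartsGE_antitone (by omega)) (lam.numPartsGE_antitone (by omega))

theorem columnSum_pos (lam : OddDistinctPartition) {j : ℕ} (hj : j < lam.numColumns) :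
    0 < lam.columnSum j := by
  have := (lam.numPartsGE_pos_iff (t := 2 * j + 1) (by omega)).2 (by unfold numColumns at hj; omega)
  unfold columnSum
  omega

theorem count_odd_le_one (lam : OddDistinctPartition) (j : ℕ) :
    lam.parts.count (2 * j + 1) ≤ 1 :=
  lam.odd_distinct _ (odd_two_mul_add_one j)

theorem numPartsGE_odd (lam : OddDistinctPartition) (j : ℕ) :
    lam.numPartsGE (2 * j + 1) = lam.numPartsGE (2 * j + 2) + lam.parts.count (2 * j + 1) :=
  lam.numPartsGE_eq_add_count _

theorem columnSum_lt_of_odd (lam : OddDistinctPartition) {i j : ℕ} (hij : i < j)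
    (hi : Odd (lam.columnSum i)) : lam.columnSum j < lam.columnSum i := by
  have h₁ := lam.numPartsGE_odd i
  have h₂ := lam.count_odd_le_one i
  have h₃ := lam.numPartsGE_antitone (show 2 * i + 2 ≤ 2 * j + 1 by omega)
  have h₄ := lam.numPartsGE_antitone (show 2 * i + 2 ≤ 2 * j + 2 by omega)
  obtain ⟨r, hr⟩ := hi
  unfold columnSum at *
  omega

/-- Conjugation: transpose the 2-modular diagram. -/
def conj (lam : OddDistinctPartition) : OddDistinctPartition where
  parts := (Multiset.range lam.numColumns).map lam.columnSum
  parts_pos p hp := by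
    obtain ⟨j, hj, rfl⟩ := Multiset.mem_map.1 hp
    exact lam.columnSum_pos (Multiset.mem_range.1 hj)
  odd_distinct p hp := by
    rw [Multiset.count_map]
    change ((Finset.range lam.numColumns).filter fun j => p = lam.columnSum j).card ≤ 1
    refine Finset.card_le_one.2 fun i hi j hj => ?_
    have hi := (Finset.mem_filter.1 hi).2
    have hj := (Finset.mem_filter.1 hj).2
    rcases lt_trichotomy i j with h | h | h
    · have := lam.columnSum_lt_of_odd h (hi ▸ hp)
      omega
    · exact h
    · have := lam.columnSum_lt_of_odd h (hj ▸ hp)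
      omega

theorem wt_conj (lam : OddDistinctPartition) : lam.conj.wt = lam.wt :=
  lam.sum_columnSum

theorem numParts_conj (lam : OddDistinctPartition) : lam.conj.numParts = lam.numColumns := by
  simp [numParts, conj]

theorem largest_conj (lam : OddDistinctPartition) : lam.conj.largest = lam.columnSum 0 := by
  refine le_antisymm (Multiset.sup_le.2 fun p hp => ?_) ?_
  · rw [conj, Multiset.mem_map] at hp
    obtain ⟨j, -, rfl⟩ := hp
    exact lam.columnSum_antitone (Nat.zero_le j)
  · rcases Nat.eq_zero_or_pos lam.numColumns with h | h
    · simp [columnSum, numPartsGE_eq_zero, h]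
    · exact Multiset.le_sup (Multiset.mem_map_of_mem _ (Multiset.mem_range.2 h))

theorem numColumns_conj (lam : OddDistinctPartition) : lam.conj.numColumns = lam.numParts := by
  have h₁ := lam.numPartsGE_eq_add_count 1
  have h₂ := lam.count_odd_le_one 0
  rw [numColumns, largest_conj, ← numPartsGE_one, columnSum]
  norm_num at *
  omega

theorem m2Rank_eq (lam : OddDistinctPartition) :
    lam.m2Rank = (lam.numColumns : ℤ) - lam.numParts := rfl

theorem conj_injective : Function.Injective conj := by
  intro lam mu h
  have hcol : lam.numColumns = mu.numColumns := by
    rw [← numParts_conj, ← numParts_conj, h]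
  have sorted (nu : OddDistinctPartition) (m : ℕ) :
      ((List.range m).map nu.columnSum).SortedGE :=
    (List.pairwise_map.2 (List.pairwise_lt_range.imp
      fun {i j} (hij : i < j) => nu.columnSum_antitone hij.le)).sortedGE
  have hlist : (List.range lam.numColumns).map lam.columnSum =
      (List.range lam.numColumns).map mu.columnSum := by
    refine List.Perm.eq_of_sortedGE (sorted _ _) (sorted _ _) (Multiset.coe_eq_coe.1 ?_)
    have := congrArg parts h
    simp only [conj, ← hcol] at this
    exact this
  have hsum (j : ℕ) (hj : j < lam.numColumns) : lam.columnSum j = mu.columnSum j :=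
    List.map_inj_left.1 hlist j (List.mem_range.2 hj)
  have hodd (j : ℕ) : lam.numPartsGE (2 * j + 1) = mu.numPartsGE (2 * j + 1) ∧
      lam.numPartsGE (2 * j + 2) = mu.numPartsGE (2 * j + 2) := by
    rcases lt_or_ge j lam.numColumns with hj | hj
    · have h₁ := lam.numPartsGE_odd j
      have h₂ := mu.numPartsGE_odd j
      have h₃ := lam.count_odd_le_one j
      have h₄ := mu.count_odd_le_one j
      have h₅ := hsum j hj
      unfold columnSum at h₅
      omega
    · rw [numPartsGE_eq_zero, numPartsGE_eq_zero, numPartsGE_eq_zero, numPartsGE_eq_zero]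
      all_goals first | exact ⟨rfl, rfl⟩ | omega
  have hGE (t : ℕ) : lam.numPartsGE (t + 1) = mu.numPartsGE (t + 1) := by
    rcases Nat.even_or_odd' t with ⟨j, rfl | rfl⟩
    · exact (hodd j).1
    · exact (hodd j).2
  refine parts_injective (Multiset.ext.2 fun p => ?_)
  cases p with
  | zero =>
    rw [Multiset.count_eq_zero_of_notMem fun h0 => (lam.parts_pos 0 h0).false,
      Multiset.count_eq_zero_of_notMem fun h0 => (mu.parts_pos 0 h0).false]
  | succ t =>
    have h₁ := lam.numPartsGE_eq_add_count (t + 1)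
    have h₂ := mu.numPartsGE_eq_add_count (t + 1)
    rw [hGE t, hGE (t + 1)] at h₁
    omega

theorem finite_setOf_wt_eq (n : ℕ) : {lam : OddDistinctPartition | lam.wt = n}.Finite := by
  refine Set.Finite.of_injOn (f := parts) (t := Set.range (Nat.Partition.parts (n := n)))
    ?_ parts_injective.injOn (Set.finite_range _)
  intro lam h
  exact ⟨⟨lam.parts, fun {p} hp => lam.parts_pos p hp, h⟩, rfl⟩

/-- The partitions of `n` without repeated odd parts. -/
noncomputable def ofWt (n : ℕ) : Finset OddDistinctPartition := (finite_setOf_wt_eq n).toFinset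

theorem mem_ofWt {n : ℕ} {lam : OddDistinctPartition} : lam ∈ ofWt n ↔ lam.wt = n := by
  simp [ofWt]

theorem sum_ofWt_conj {M : Type*} [AddCommMonoid M] (n : ℕ) (f : OddDistinctPartition → M) :
    ∑ lam ∈ ofWt n, f lam.conj = ∑ lam ∈ ofWt n, f lam := by
  have hmaps : Set.MapsTo conj (ofWt n) (ofWt n) := fun lam h =>
    mem_ofWt.2 ((wt_conj lam).trans (mem_ofWt.1 h))
  exact Finset.sum_nbij conj hmaps conj_injective.injOn
    (Finset.surjOn_of_injOn_of_card_le conj hmaps conj_injective.injOn le_rfl) fun _ _ => rfl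

theorem m2Rank_modEq_iff (lam : OddDistinctPartition) (b k : ℕ) :
    lam.m2Rank ≡ b [ZMOD k] ↔ (lam.numColumns - lam.numParts : ZMod k) = b := by
  rw [← ZMod.intCast_eq_intCast_iff, m2Rank_eq]
  push_cast
  rfl

open Classical in
theorem N2_eq_sum (b k n : ℕ) :
    N2 b k n = ∑ lam ∈ ofWt n,
      if (lam.numColumns - lam.numParts : ZMod k) = b then 1 else 0 := by
  rw [← Finset.card_filter]
  refine Nat.subtype_card _ fun lam => ?_
  rw [Finset.mem_filter, mem_ofWt, m2Rank_modEq_iff]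

open Classical in
theorem NT2_eq_sum (b k n : ℕ) :
    NT2 b k n = ∑ lam ∈ ofWt n,
      if (lam.numColumns - lam.numParts : ZMod k) = b then lam.numParts else 0 := by
  rw [← Finset.sum_filter]
  trans (((ofWt n).filter fun lam => (lam.numColumns - lam.numParts : ZMod k) = b).sigma
    fun lam => Finset.range lam.numParts).card
  · rw [← Nat.subtype_card _ fun _ => Iff.rfl]
    refine Nat.card_congr ((Equiv.sigmaEquivProd _ _).symm.subtypeEquiv fun p => ?_)
    simp [mem_ofWt, m2Rank_modEq_iff, and_assoc]
  · simp

end OddDistinctPartition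

open OddDistinctPartition in
/-- The M2-rank Andrews-Beck type totals for partitions without repeated odd parts are
congruent modulo 5 to a difference of M2-rank counts. -/
theorem NT2_congr_N2 (n : ℕ) :
    ((NT2 1 5 n : ℤ) - (NT2 4 5 n : ℤ) + 2 * (NT2 2 5 n : ℤ) - 2 * (NT2 3 5 n : ℤ)) ≡
      ((N2 2 5 n : ℤ) - (N2 1 5 n : ℤ)) [ZMOD 5] := by
  classical
  suffices h : 2 * ((NT2 1 5 n : ZMod 5) - NT2 4 5 n + 2 * NT2 2 5 n - 2 * NT2 3 5 n) =
      2 * ((N2 2 5 n : ZMod 5) - N2 1 5 n) by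
    refine (ZMod.intCast_eq_intCast_iff _ _ 5).1 ?_
    push_cast
    have cancel : ∀ x y : ZMod 5, 2 * x = 2 * y → x = y := by decide
    exact cancel _ _ h
  have hNT : (NT2 1 5 n : ZMod 5) - NT2 4 5 n + 2 * NT2 2 5 n - 2 * NT2 3 5 n =
      ∑ lam ∈ ofWt n, (lam.numParts : ZMod 5) * (lam.numColumns - lam.numParts) := by
    simp only [NT2_eq_sum, Nat.cast_sum, Finset.mul_sum, ← Finset.sum_sub_distrib,
      ← Finset.sum_add_distrib]
    refine Finset.sum_congr rfl fun lam _ => ?_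
    push_cast
    generalize (lam.numParts : ZMod 5) = a
    generalize (lam.numColumns : ZMod 5) = b
    revert a b
    decide
  have hN : (N2 2 5 n : ZMod 5) - N2 1 5 n =
      ∑ lam ∈ ofWt n, ((if (lam.numColumns - lam.numParts : ZMod 5) = 2 then 1 else 0) -
        if (lam.numColumns - lam.numParts : ZMod 5) = 1 then 1 else 0) := by
    simp only [N2_eq_sum, Nat.cast_sum, ← Finset.sum_sub_distrib]
    exact Finset.sum_congr rfl fun lam _ => by push_cast; rfl
  rw [hNT, hN, two_mul, two_mul]
  nth_rw 1 [← sum_ofWt_conj]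
  nth_rw 3 [← sum_ofWt_conj]
  rw [← Finset.sum_add_distrib, ← Finset.sum_add_distrib]
  refine Finset.sum_congr rfl fun lam _ => ?_
  rw [numParts_conj, numColumns_conj]
  generalize (lam.numParts : ZMod 5) = a
  generalize (lam.numColumns : ZMod 5) = b
  revert a b
  decide
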